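/- Consider the model y = Xβ* + ε with ε ~ N(0, σ²I_n), where β* has support of cardinality s and columns of X satisfy ‖X_j‖₂² = n. Suppose X satisfies RE(3, s) and λ₁ = 2σ√(2 log(p/δ)/n) for δ ∈ (0,1). Then for any λ₂ > 0, with probability at least 1 − δ the Boosted Lasso β̄ = β̂^{λ₁,λ₂} satisfies (1/n)‖X(β* − β̄)‖₂² + (2λ₂ − λ₁)‖β̄ − β̂^{λ₁}‖₁ ≤ 9λ₁²s/(4κ²(3, s)). -/

import Mathlib

open MeasureTheory ProbabilityTheory Finset

noncomputable section

/-- Product Gaussian measure `N(0, σ² I_n)` on `ℝⁿ`. -/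
def gaussianVec (n : ℕ) (σ : ℝ) : Measure (Fin n → ℝ) :=
  Measure.pi fun _ => gaussianReal 0 (σ ^ 2).toNNReal

/-- Squared Euclidean norm. -/
def l2sq {m : ℕ} (v : Fin m → ℝ) : ℝ := ∑ i, (v i) ^ 2

/-- Euclidean norm. -/
def l2 {m : ℕ} (v : Fin m → ℝ) : ℝ := Real.sqrt (l2sq v)

/-- ℓ₁ norm. -/
def l1 {m : ℕ} (v : Fin m → ℝ) : ℝ := ∑ i, |v i|

/-- Lasso objective `(1/2n)‖y − Xβ‖₂² + λ‖β‖₁`. -/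
def lassoObj {n p : ℕ} (X : Matrix (Fin n) (Fin p) ℝ) (y : Fin n → ℝ) (lam : ℝ)
    (β : Fin p → ℝ) : ℝ :=
  l2sq (y - X.mulVec β) / (2 * (n : ℝ)) + lam * l1 β

/-- `b` is a Lasso solution with tuning parameter `lam`. -/
def IsLassoSol {n p : ℕ} (X : Matrix (Fin n) (Fin p) ℝ) (y : Fin n → ℝ) (lam : ℝ)
    (b : Fin p → ℝ) : Prop :=
  ∀ β : Fin p → ℝ, lassoObj X y lam b ≤ lassoObj X y lam β

/-- Restricted eigenvalue condition RE(c₀, s) with constant `κ`: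
for every `J` with `|J| ≤ s` and every `Δ` with `‖Δ_{Jᶜ}‖₁ ≤ c₀‖Δ_J‖₁`,
one has `‖XΔ‖₂² ≥ κ² n ‖Δ_J‖₂²`. -/
def RE {n p : ℕ} (X : Matrix (Fin n) (Fin p) ℝ) (c0 : ℝ) (s : ℕ) (κ : ℝ) : Prop :=
  0 < κ ∧ ∀ J : Finset (Fin p), J.card ≤ s → ∀ Δ : Fin p → ℝ,
    (∑ j ∈ Jᶜ, |Δ j|) ≤ c0 * ∑ j ∈ J, |Δ j| →
    κ ^ 2 * ((n : ℝ) * ∑ j ∈ J, (Δ j) ^ 2) ≤ l2sq (X.mulVec Δ)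

/-- The Lasso subgradient `ρ̂ = Xᵀ(y − Xβ̂)/(λ n)`. -/
def lassoSubgrad {n p : ℕ} (X : Matrix (Fin n) (Fin p) ℝ) (y : Fin n → ℝ) (lam : ℝ)
    (b : Fin p → ℝ) : Fin p → ℝ :=
  fun j => (X.transpose.mulVec (y - X.mulVec b)) j / (lam * (n : ℝ))

/-- Boosted Lasso objective `(1/2n)‖y − Xβ‖₂² + λ₂‖β − β̂‖₁`. -/
def boostedObj {n p : ℕ} (X : Matrix (Fin n) (Fin p) ℝ) (y : Fin n → ℝ) (lam2 : ℝ)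
    (bhat β : Fin p → ℝ) : ℝ :=
  l2sq (y - X.mulVec β) / (2 * (n : ℝ)) + lam2 * l1 (β - bhat)

/-- `b` is a Boosted Lasso solution built upon the first-step estimator `bhat`. -/
def IsBoostedSol {n p : ℕ} (X : Matrix (Fin n) (Fin p) ℝ) (y : Fin n → ℝ) (lam2 : ℝ)
    (bhat b : Fin p → ℝ) : Prop :=
  ∀ β : Fin p → ℝ, boostedObj X y lam2 bhat b ≤ boostedObj X y lam2 bhat β

/-- Bregman Lasso objective
`(1/2n)‖y − Xβ‖₂² + λ₂(‖β‖₁ − ⟨ρ̂^{λ₁}, β⟩)` where `ρ̂^{λ₁}` is the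
Lasso subgradient associated with `bhat`. -/
def bregmanObj {n p : ℕ} (X : Matrix (Fin n) (Fin p) ℝ) (y : Fin n → ℝ) (lam1 lam2 : ℝ)
    (bhat β : Fin p → ℝ) : ℝ :=
  l2sq (y - X.mulVec β) / (2 * (n : ℝ)) +
    lam2 * (l1 β - ∑ j, lassoSubgrad X y lam1 bhat j * β j)

/-- `b` is a Bregman Lasso solution with parameters `(lam1, lam2)`. -/
def IsBregmanSol {n p : ℕ} (X : Matrix (Fin n) (Fin p) ℝ) (y : Fin n → ℝ) (lam1 lam2 : ℝ)
    (bhat b : Fin p → ℝ) : Prop :=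
  ∀ β : Fin p → ℝ, bregmanObj X y lam1 lam2 bhat b ≤ bregmanObj X y lam1 lam2 bhat β

/-- `bbar` is a sign-consistent refitting of the Lasso solution `bhat`:
it does not increase the residual norm and `(1/n)Xᵀ(y − Xβ̂) ∈ λ·sign(β̄)`
componentwise. -/
def SignConsistentRefit {n p : ℕ} (X : Matrix (Fin n) (Fin p) ℝ) (y : Fin n → ℝ) (lam : ℝ)
    (bhat bbar : Fin p → ℝ) : Prop :=
  l2 (y - X.mulVec bbar) ≤ l2 (y - X.mulVec bhat) ∧
  ∀ j, (0 < bbar j → X.transpose.mulVec (y - X.mulVec bhat) j / (n : ℝ) = lam) ∧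
       (bbar j < 0 → X.transpose.mulVec (y - X.mulVec bhat) j / (n : ℝ) = -lam) ∧
       (bbar j = 0 → |X.transpose.mulVec (y - X.mulVec bhat) j / (n : ℝ)| ≤ lam)

/-- `bbar` is a Sign-Least-Squares Lasso refitting of the Lasso solution `bhat`:
it vanishes outside the equicorrelation set `E = {j : |ρ̂_j| = 1}` and minimizes
the residual sum of squares among all vectors supported on `E` whose coordinates
have signs compatible with `ρ̂_E`. -/
def IsSLSSol {n p : ℕ} (X : Matrix (Fin n) (Fin p) ℝ) (y : Fin n → ℝ) (lam : ℝ)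
    (bhat bbar : Fin p → ℝ) : Prop :=
  (∀ j, |lassoSubgrad X y lam bhat j| ≠ 1 → bbar j = 0) ∧
  (∀ j, 0 ≤ lassoSubgrad X y lam bhat j * bbar j) ∧
  ∀ β : Fin p → ℝ,
    ((∀ j, |lassoSubgrad X y lam bhat j| ≠ 1 → β j = 0) ∧
     (∀ j, 0 ≤ lassoSubgrad X y lam bhat j * β j)) →
    l2sq (y - X.mulVec bbar) ≤ l2sq (y - X.mulVec β)

/-- Componentwise soft-thresholding operator `softThresh(y, λ)_j = sign(y_j)(|y_j| − λ)₊`. -/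
def softThresh {p : ℕ} (y : Fin p → ℝ) (lam : ℝ) : Fin p → ℝ :=
  fun j => Real.sign (y j) * max (|y j| - lam) 0

/-- Componentwise firm-thresholding (MCP) operator. -/
def MCP {p : ℕ} (y : Fin p → ℝ) (μ γ : ℝ) : Fin p → ℝ :=
  fun j => if |y j| ≤ μ * γ then γ / (γ - 1) * (Real.sign (y j) * max (|y j| - μ) 0) else y j

/-- Bregman objective in the denoising (orthogonal, `X = I_p`) case:
`(1/2)‖y − β‖₂² + λ(‖β‖₁ − ⟨ρ, β⟩)`. -/
def denoiseBregObj {p : ℕ} (y ρ : Fin p → ℝ) (lam : ℝ) (β : Fin p → ℝ) : ℝ :=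
  (1 / 2) * l2sq (y - β) + lam * (l1 β - ∑ j, ρ j * β j)

end

open scoped ENNReal NNReal in
lemma gaussianReal_apply_le_exp_mul (t : ℝ) {v : ℝ≥0} (hv : v ≠ 0) {s : Set ℝ}
    (hst : ∀ x ∈ s, 0 ≤ t * x) :
    gaussianReal (-t) v s ≤ ENNReal.ofReal (Real.exp (-t ^ 2 / (2 * v))) * gaussianReal 0 v s := by
  rw [gaussianReal_apply _ hv, gaussianReal_apply _ hv,
    ← lintegral_const_mul _ (measurable_gaussianPDF 0 v)]
  refine setLIntegral_mono (by fun_prop) fun x hx ↦ ?_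
  rw [gaussianPDF, gaussianPDF, ← ENNReal.ofReal_mul (Real.exp_pos _).le]
  refine ENNReal.ofReal_le_ofReal ?_
  simp only [gaussianPDFReal]
  rw [mul_left_comm, ← Real.exp_add, ← add_div]
  gcongr
  nlinarith [hst x hx]

open scoped ENNReal NNReal in
/-- The Gaussian tail bound without a factor two. -/
lemma gaussianReal_lt_abs_le {t : ℝ} (ht : 0 ≤ t) {v : ℝ≥0} (hv : v ≠ 0) :
    gaussianReal 0 v {x | t < |x|} ≤ ENNReal.ofReal (Real.exp (-t ^ 2 / (2 * v))) := by
  have h1 : gaussianReal 0 v (Set.Ioi t) = gaussianReal (-t) v (Set.Ioi 0) := by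
    have := gaussianReal_map_add_const (μ := 0) (v := v) (-t)
    rw [zero_add] at this
    rw [← this, Measure.map_apply (by fun_prop) measurableSet_Ioi]
    congr 1
    ext x
    simp
  have h2 : gaussianReal 0 v (Set.Iio (-t)) = gaussianReal (- -t) v (Set.Iio 0) := by
    have := gaussianReal_map_add_const (μ := 0) (v := v) (- -t)
    rw [zero_add] at this
    rw [← this, Measure.map_apply (by fun_prop) measurableSet_Iio]
    congr 1
    ext x
    simp [lt_neg_iff_add_neg]
  have h3 := gaussianReal_apply_le_exp_mul t hv (s := Set.Ioi 0)
    fun x (hx : 0 < x) ↦ mul_nonneg ht hx.le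
  have h4 := gaussianReal_apply_le_exp_mul (-t) hv (s := Set.Iio 0)
    fun x (hx : x < 0) ↦ by nlinarith
  rw [neg_sq] at h4
  have hsub : {x : ℝ | t < |x|} ⊆ Set.Ioi t ∪ Set.Iio (-t) := fun x (hx : t < |x|) ↦ by
    rcases lt_abs.1 hx with h | h
    · exact Or.inl h
    · exact Or.inr (lt_neg.1 h)
  have hdisj : Disjoint (Set.Ioi (0 : ℝ)) (Set.Iio 0) := by
    rw [Set.disjoint_left]
    exact fun x (hx : 0 < x) (hx' : x < 0) ↦ lt_asymm hx hx'
  calc gaussianReal 0 v {x | t < |x|}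
      ≤ gaussianReal 0 v (Set.Ioi t) + gaussianReal 0 v (Set.Iio (-t)) :=
        (measure_mono hsub).trans (measure_union_le _ _)
    _ ≤ ENNReal.ofReal (Real.exp (-t ^ 2 / (2 * v))) *
          (gaussianReal 0 v (Set.Ioi 0) + gaussianReal 0 v (Set.Iio 0)) := by
        rw [h1, h2, mul_add]
        exact add_le_add h3 h4
    _ ≤ ENNReal.ofReal (Real.exp (-t ^ 2 / (2 * v))) := by
        rw [← measure_union hdisj measurableSet_Iio]
        exact mul_le_of_le_one_right' prob_le_one

open scoped NNReal in
/-- A linear form of a centred Gaussian vector with i.i.d. coordinates is Gaussian. -/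
lemma map_sum_mul_pi_gaussianReal {ι : Type*} [Fintype ι] (c : ι → ℝ) (v : ℝ≥0) :
    (Measure.pi fun _ : ι ↦ gaussianReal 0 v).map (fun ε ↦ ∑ i, c i * ε i) =
      gaussianReal 0 ((∑ i, c i ^ 2).toNNReal * v) := by
  have hind : iIndepFun (fun i (ε : ι → ℝ) ↦ c i * ε i)
      (Measure.pi fun _ : ι ↦ gaussianReal 0 v) :=
    iIndepFun_pi (X := fun i x ↦ c i * x) fun i ↦ by fun_prop
  have hmap (i : ι) : (Measure.pi fun _ : ι ↦ gaussianReal 0 v).map (fun ε ↦ c i * ε i) =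
      gaussianReal 0 (.mk (c i ^ 2) (sq_nonneg _) * v) := by
    have h := gaussianReal_map_const_mul (μ := 0) (v := v) (c i)
    rw [mul_zero] at h
    have he := (measurePreserving_eval (fun _ : ι ↦ gaussianReal 0 v) i).map_eq
    rw [← h]
    conv_rhs => rw [← he]
    rw [Measure.map_map (by fun_prop) (by fun_prop)]
    rfl
  refine Measure.ext_of_charFun ?_
  ext t
  have hmeas (i : ι) : AEMeasurable (fun ε : ι → ℝ ↦ c i * ε i)
      (Measure.pi fun _ : ι ↦ gaussianReal 0 v) :=
    Measurable.aemeasurable (by fun_prop)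
  rw [hind.charFun_map_fun_sum_eq_prod hmeas, Finset.prod_apply]
  simp only [hmap, charFun_gaussianReal]
  rw [← Complex.exp_sum]
  congr 1
  have hnn : 0 ≤ ∑ i, c i ^ 2 := Finset.sum_nonneg fun i _ ↦ sq_nonneg _
  simp [Real.coe_toNNReal _ hnn, Finset.sum_mul, Finset.sum_div]

lemma l2sq_add {m : ℕ} (u v : Fin m → ℝ) :
    l2sq (u + v) = l2sq u + 2 * (u ⬝ᵥ v) + l2sq v := by
  simp only [l2sq, dotProduct, Pi.add_apply, Finset.mul_sum, ← Finset.sum_add_distrib]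
  exact Finset.sum_congr rfl fun i _ ↦ by ring

lemma l2sq_smul {m : ℕ} (t : ℝ) (v : Fin m → ℝ) : l2sq (t • v) = t ^ 2 * l2sq v := by
  simp [l2sq, Finset.mul_sum, mul_pow]

lemma l2sq_neg {m : ℕ} (v : Fin m → ℝ) : l2sq (-v) = l2sq v := by
  simp [l2sq]

lemma l2sq_nonneg {m : ℕ} (v : Fin m → ℝ) : 0 ≤ l2sq v :=
  Finset.sum_nonneg fun _ _ ↦ sq_nonneg _

lemma l1_neg {m : ℕ} (v : Fin m → ℝ) : l1 (-v) = l1 v := by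
  simp [l1]

lemma convexOn_mul_l1_sub {m : ℕ} {lam : ℝ} (hlam : 0 ≤ lam) (c : Fin m → ℝ) :
    ConvexOn ℝ Set.univ fun β ↦ lam * l1 (β - c) := by
  refine ⟨convex_univ, fun x _ y _ a b ha hb hab ↦ ?_⟩
  simp only [l1, smul_eq_mul]
  rw [mul_left_comm a, mul_left_comm b, ← mul_add, Finset.mul_sum univ _ a, Finset.mul_sum univ _ b,
    ← Finset.sum_add_distrib]
  refine mul_le_mul_of_nonneg_left (Finset.sum_le_sum fun i _ ↦ ?_) hlam
  have h : (a • x + b • y - c) i = a * (x - c) i + b * (y - c) i := by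
    simp only [Pi.add_apply, Pi.sub_apply, Pi.smul_apply, smul_eq_mul]
    linear_combination c i * hab
  rw [h]
  refine (abs_add_le _ _).trans_eq ?_
  rw [abs_mul, abs_mul, abs_of_nonneg ha, abs_of_nonneg hb]

lemma le_of_forall_le_add_mul {a b c : ℝ} (h : ∀ t ∈ Set.Ioo (0 : ℝ) 1, a ≤ b + t * c) :
    a ≤ b := by
  have hlim : Filter.Tendsto (fun t : ℝ ↦ b + t * c) (nhdsWithin 0 (Set.Ioi 0)) (nhds b) := by
    have : Continuous fun t : ℝ ↦ b + t * c := by fun_prop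
    simpa using (this.tendsto 0).mono_left nhdsWithin_le_nhds
  refine ge_of_tendsto hlim ?_
  filter_upwards [Ioo_mem_nhdsGT (zero_lt_one' ℝ)] with t ht using h t ht

/-- First-order optimality condition for penalised least squares with a convex penalty. -/
lemma dotProduct_residual_le_of_minimizer {n p : ℕ} (X : Matrix (Fin n) (Fin p) ℝ)
    (y : Fin n → ℝ) {g : (Fin p → ℝ) → ℝ} (hg : ConvexOn ℝ Set.univ g) {b : Fin p → ℝ}
    (hb : ∀ β, l2sq (y - X.mulVec b) / (2 * (n : ℝ)) + g b ≤
      l2sq (y - X.mulVec β) / (2 * (n : ℝ)) + g β) (β : Fin p → ℝ) :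
    (y - X.mulVec b) ⬝ᵥ X.mulVec (β - b) / (n : ℝ) ≤ g β - g b := by
  refine le_of_forall_le_add_mul (c := l2sq (X.mulVec (β - b)) / (2 * (n : ℝ)))
    fun t ht ↦ ?_
  have hcomb : (1 - t) • b + t • β = b + t • (β - b) := by
    rw [sub_smul, smul_sub, one_smul]; abel
  have hconv := hg.2 (Set.mem_univ b) (Set.mem_univ β) (sub_nonneg.2 ht.2.le) ht.1.le
    (sub_add_cancel 1 t)
  have hmin := hb (b + t • (β - b))
  rw [hcomb] at hconv
  have hres : y - X.mulVec (b + t • (β - b)) =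
      (y - X.mulVec b) + (-t) • X.mulVec (β - b) := by
    rw [Matrix.mulVec_add, Matrix.mulVec_smul, neg_smul]; abel
  rw [hres, l2sq_add, l2sq_smul, dotProduct_smul] at hmin
  simp only [smul_eq_mul] at hconv hmin
  set A := (y - X.mulVec b) ⬝ᵥ X.mulVec (β - b)
  set Q := l2sq (X.mulVec (β - b))
  have hsplit : (l2sq (y - X.mulVec b) + 2 * (-t * A) + (-t) ^ 2 * Q) / (2 * (n : ℝ)) =
      l2sq (y - X.mulVec b) / (2 * (n : ℝ)) + t * (t * (Q / (2 * n)) - A / n) := by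
    field_simp
    ring
  rw [hsplit] at hmin
  have hmul : 0 ≤ t * (g β - g b + t * (Q / (2 * n)) - A / n) := by nlinarith
  have := nonneg_of_mul_nonneg_right hmul ht.1
  linarith

lemma abs_dotProduct_mulVec_le {n p : ℕ} (X : Matrix (Fin n) (Fin p) ℝ) (ε : Fin n → ℝ)
    {c : ℝ} (hε : ∀ j, |∑ i, X i j * ε i| ≤ c) (v : Fin p → ℝ) :
    |ε ⬝ᵥ X.mulVec v| ≤ c * l1 v := by
  rw [Matrix.dotProduct_mulVec, l1, Finset.mul_sum, dotProduct]
  refine (Finset.abs_sum_le_sum_abs _ _).trans (Finset.sum_le_sum fun j _ ↦ ?_)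
  rw [abs_mul]
  refine mul_le_mul_of_nonneg_right ?_ (abs_nonneg _)
  simpa [Matrix.vecMul, dotProduct, mul_comm] using hε j

/-- Prediction bound for the Lasso on the event where the noise correlations are at most
half the tuning parameter. -/
lemma l2sq_mulVec_lasso_sub_le {n p s : ℕ} (hn : 0 < n) (X : Matrix (Fin n) (Fin p) ℝ)
    (bstar : Fin p → ℝ) (hs : (Finset.univ.filter fun j => bstar j ≠ 0).card = s)
    {κ : ℝ} (hRE : RE X 3 s κ) {lam : ℝ} (hlam : 0 < lam) {ε : Fin n → ℝ}
    (hε : ∀ j, |∑ i, X i j * ε i| ≤ n * lam / 2) {bhat : Fin p → ℝ}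
    (hb : IsLassoSol X (X.mulVec bstar + ε) lam bhat) :
    l2sq (X.mulVec (bstar - bhat)) / (n : ℝ) ≤ 9 * lam ^ 2 * (s : ℝ) / (4 * κ ^ 2) := by
  obtain ⟨hκ, hRE⟩ := hRE
  have hn' : (0 : ℝ) < n := by exact_mod_cast hn
  set J := Finset.univ.filter fun j => bstar j ≠ 0 with hJ
  set h := bstar - bhat with hh
  have hopt := dotProduct_residual_le_of_minimizer X (X.mulVec bstar + ε)
    (convexOn_mul_l1_sub hlam.le 0) (b := bhat) (fun β ↦ by simpa [lassoObj] using hb β) bstar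
  rw [show X.mulVec bstar + ε - X.mulVec bhat = X.mulVec h + ε by
    rw [hh, Matrix.mulVec_sub]; abel, ← hh, add_dotProduct] at hopt
  simp only [sub_zero] at hopt
  have hself : X.mulVec h ⬝ᵥ X.mulVec h = l2sq (X.mulVec h) := by
    simp [l2sq, dotProduct, sq]
  rw [hself, div_le_iff₀ hn'] at hopt
  have hnoise := neg_le_of_abs_le (abs_dotProduct_mulVec_le X ε hε h)
  have hsplit (v : Fin p → ℝ) : l1 v = ∑ j ∈ J, |v j| + ∑ j ∈ Jᶜ, |v j| :=
    (Finset.sum_add_sum_compl J _).symm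
  have hJc (j : Fin p) (hj : j ∈ Jᶜ) : bstar j = 0 := by simpa [hJ] using hj
  have hdiff : l1 bstar - l1 bhat ≤ ∑ j ∈ J, |h j| - ∑ j ∈ Jᶜ, |h j| := by
    have h1 : ∑ j ∈ Jᶜ, |bstar j| = 0 :=
      Finset.sum_eq_zero fun j hj ↦ by rw [hJc j hj, abs_zero]
    have h2 : ∑ j ∈ Jᶜ, |bhat j| = ∑ j ∈ Jᶜ, |h j| :=
      Finset.sum_congr rfl fun j hj ↦ by simp [hh, hJc j hj]
    have h3 : ∑ j ∈ J, |bstar j| ≤ ∑ j ∈ J, |h j| + ∑ j ∈ J, |bhat j| := by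
      rw [← Finset.sum_add_distrib]
      refine Finset.sum_le_sum fun j _ ↦ ?_
      simpa [hh] using abs_add_le (h j) (bhat j)
    rw [hsplit bstar, hsplit bhat, h1, h2]
    linarith
  rw [hsplit h] at hnoise
  set a := ∑ j ∈ J, |h j|
  set c := ∑ j ∈ Jᶜ, |h j|
  set S := l2sq (X.mulVec h)
  have hS : 0 ≤ S := l2sq_nonneg _
  have hc : 0 ≤ c := Finset.sum_nonneg fun _ _ ↦ abs_nonneg _
  have hbasic : S ≤ n * lam / 2 * (3 * a - c) := by
    have := mul_le_mul_of_nonneg_left hdiff (mul_pos hn' hlam).le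
    nlinarith
  have hcone : c ≤ 3 * a := by
    have := nonneg_of_mul_nonneg_right (hS.trans hbasic) (by positivity)
    linarith
  have hre := hRE J hs.le h hcone
  have hcs : a ^ 2 ≤ s * ∑ j ∈ J, h j ^ 2 := by
    have := sq_sum_le_card_mul_sum_sq (s := J) (f := fun j ↦ |h j|)
    simpa only [sq_abs, hs] using this
  have hSa : S ≤ 3 * n * lam / 2 * a := by
    have : 0 ≤ n * lam / 2 * c := by positivity
    linarith
  have hsq : κ ^ 2 * n * a ^ 2 ≤ s * S := by
    have h1 := mul_le_mul_of_nonneg_left hcs (by positivity : 0 ≤ κ ^ 2 * (n : ℝ))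
    have h2 := mul_le_mul_of_nonneg_left hre (Nat.cast_nonneg (α := ℝ) s)
    linarith
  rw [div_le_div_iff₀ hn' (by positivity)]
  rcases hS.eq_or_lt with h0 | hpos
  · rw [← h0, zero_mul]; positivity
  refine le_of_mul_le_mul_left ?_ hpos
  calc S * (S * (4 * κ ^ 2)) = 4 * κ ^ 2 * S ^ 2 := by ring
    _ ≤ 4 * κ ^ 2 * (3 * n * lam / 2 * a) ^ 2 := by gcongr
    _ = 9 * n * lam ^ 2 * (κ ^ 2 * n * a ^ 2) := by ring
    _ ≤ 9 * n * lam ^ 2 * (s * S) := by gcongr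
    _ = S * (9 * lam ^ 2 * s * n) := by ring

/-- The penalised prediction error after boosting is at most the prediction error before it. -/
lemma l2sq_mulVec_boosted_add_le {n p : ℕ} (hn : 0 < n) (X : Matrix (Fin n) (Fin p) ℝ)
    (bstar : Fin p → ℝ) {lam1 lam2 : ℝ} (hlam2 : 0 ≤ lam2) {ε : Fin n → ℝ}
    (hε : ∀ j, |∑ i, X i j * ε i| ≤ n * lam1 / 2) {bhat bb : Fin p → ℝ}
    (hbb : IsBoostedSol X (X.mulVec bstar + ε) lam2 bhat bb) :
    l2sq (X.mulVec (bstar - bb)) / (n : ℝ) + (2 * lam2 - lam1) * l1 (bb - bhat) ≤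
      l2sq (X.mulVec (bstar - bhat)) / (n : ℝ) := by
  have hn' : (0 : ℝ) < n := by exact_mod_cast hn
  have hopt := dotProduct_residual_le_of_minimizer X (X.mulVec bstar + ε)
    (convexOn_mul_l1_sub hlam2 bhat) (b := bb) hbb bhat
  have hzero : l1 (bhat - bhat) = 0 := by simp [l1]
  rw [hzero, show X.mulVec bstar + ε - X.mulVec bb = X.mulVec (bstar - bb) + ε by
    rw [Matrix.mulVec_sub]; abel, add_dotProduct, ← neg_sub bb bhat, Matrix.mulVec_neg,
    dotProduct_neg, dotProduct_neg, div_le_iff₀ hn'] at hopt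
  have hnoise := le_of_abs_le (abs_dotProduct_mulVec_le X ε hε (bb - bhat))
  have hexp : l2sq (X.mulVec (bstar - bhat)) = l2sq (X.mulVec (bstar - bb)) +
      2 * (X.mulVec (bstar - bb) ⬝ᵥ X.mulVec (bb - bhat)) + l2sq (X.mulVec (bb - bhat)) := by
    rw [← l2sq_add, ← Matrix.mulVec_add, sub_add_sub_cancel]
  have hQ := l2sq_nonneg (X.mulVec (bb - bhat))
  rw [le_div_iff₀ hn', add_mul, div_mul_cancel₀ _ hn'.ne', hexp]
  linarith

/-- The noise correlations with the columns of a normalised design are uniformly small with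
high probability. -/
lemma le_gaussianVec_noise_event {n p : ℕ} (hn : 0 < n) (hp : 0 < p) {σ : ℝ} (hσ : 0 < σ)
    (X : Matrix (Fin n) (Fin p) ℝ) (hX : ∀ j, ∑ i, (X i j) ^ 2 = (n : ℝ))
    {δ : ℝ} (hδ : δ ∈ Set.Ioo (0 : ℝ) 1) {lam : ℝ}
    (hlam : lam = 2 * σ * Real.sqrt (2 * Real.log ((p : ℝ) / δ) / (n : ℝ))) :
    ENNReal.ofReal (1 - δ) ≤
      gaussianVec n σ {ε | ∀ j, |∑ i, X i j * ε i| ≤ n * lam / 2} := by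
  have hn' : (0 : ℝ) < n := by exact_mod_cast hn
  have hp' : (1 : ℝ) ≤ p := by exact_mod_cast hp
  have hlog : 0 ≤ Real.log (p / δ) :=
    Real.log_nonneg ((one_le_div hδ.1).2 (hδ.2.le.trans hp'))
  have hlam0 : 0 ≤ lam := by rw [hlam]; positivity
  have hv : (n : ℝ).toNNReal * (σ ^ 2).toNNReal ≠ 0 := by
    rw [← Real.toNNReal_mul hn'.le]
    exact (Real.toNNReal_pos.2 (by positivity)).ne'
  have hexp : Real.exp (-(n * lam / 2) ^ 2 /
      (2 * ((n : ℝ).toNNReal * (σ ^ 2).toNNReal : NNReal))) = δ / p := by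
    rw [NNReal.coe_mul, Real.coe_toNNReal _ hn'.le, Real.coe_toNNReal _ (sq_nonneg σ), hlam]
    have : -(n * (2 * σ * Real.sqrt (2 * Real.log (p / δ) / n)) / 2) ^ 2 / (2 * (n * σ ^ 2)) =
        -(n * Real.sqrt (2 * Real.log (p / δ) / n) ^ 2 / 2) := by
      field_simp
    rw [this, Real.sq_sqrt (by positivity), mul_div_cancel₀ _ hn'.ne',
      mul_div_cancel_left₀ _ two_ne_zero, Real.exp_neg,
      Real.exp_log (div_pos (by positivity) hδ.1), inv_div]
  have htail (j : Fin p) : gaussianVec n σ {ε | n * lam / 2 < |∑ i, X i j * ε i|} ≤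
      ENNReal.ofReal (δ / p) := by
    have hmap := map_sum_mul_pi_gaussianReal (fun i ↦ X i j) (σ ^ 2).toNNReal
    rw [hX j] at hmap
    have h := gaussianReal_lt_abs_le (t := n * lam / 2) (by positivity) hv
    rw [hexp, ← hmap, Measure.map_apply (by fun_prop)
      (measurableSet_lt measurable_const (by fun_prop))] at h
    exact h
  have : IsProbabilityMeasure (gaussianVec n σ) := by unfold gaussianVec; infer_instance
  have hmeas : MeasurableSet {ε : Fin n → ℝ | ∀ j, |∑ i, X i j * ε i| ≤ n * lam / 2} := by
    rw [Set.ofPred_forall]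
    exact MeasurableSet.iInter fun j ↦ measurableSet_le (by fun_prop) measurable_const
  have hcompl : gaussianVec n σ {ε | ∀ j, |∑ i, X i j * ε i| ≤ n * lam / 2}ᶜ ≤
      ENNReal.ofReal δ := by
    have hset : {ε : Fin n → ℝ | ∀ j, |∑ i, X i j * ε i| ≤ n * lam / 2}ᶜ =
        ⋃ j, {ε | n * lam / 2 < |∑ i, X i j * ε i|} := by
      ext ε
      simp
    rw [hset]
    refine (measure_iUnion_fintype_le _ _).trans ((Finset.sum_le_sum fun j _ ↦ htail j).trans ?_)
    rw [Finset.sum_const, Finset.card_univ, Fintype.card_fin, nsmul_eq_mul,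
      ← ENNReal.ofReal_natCast, ← ENNReal.ofReal_mul (by positivity),
      mul_div_cancel₀ _ (by positivity)]
  rw [ENNReal.ofReal_sub _ hδ.1.le, ENNReal.ofReal_one, tsub_le_iff_right,
    ← prob_add_prob_compl (μ := gaussianVec n σ) hmeas]
  gcongr

theorem stmt7 (n p s : ℕ) (hn : 0 < n) (hp : 0 < p) (σ : ℝ) (hσ : 0 < σ)
    (X : Matrix (Fin n) (Fin p) ℝ)
    (hX : ∀ j, ∑ i, (X i j) ^ 2 = (n : ℝ))
    (bstar : Fin p → ℝ)
    (hs : (Finset.univ.filter fun j => bstar j ≠ 0).card = s)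
    (κ3 : ℝ) (hRE : RE X 3 s κ3)
    (δ : ℝ) (hδ : δ ∈ Set.Ioo (0 : ℝ) 1)
    (lam1 : ℝ) (hlam1 : lam1 = 2 * σ * Real.sqrt (2 * Real.log ((p : ℝ) / δ) / (n : ℝ)))
    (lam2 : ℝ) (hlam2 : 0 < lam2) :
    ENNReal.ofReal (1 - δ) ≤
      gaussianVec n σ
        {ε | ∀ bhat bb : Fin p → ℝ,
          IsLassoSol X (X.mulVec bstar + ε) lam1 bhat →
          IsBoostedSol X (X.mulVec bstar + ε) lam2 bhat bb →
          l2sq (X.mulVec (bstar - bb)) / (n : ℝ) + (2 * lam2 - lam1) * l1 (bb - bhat) ≤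
            9 * lam1 ^ 2 * (s : ℝ) / (4 * κ3 ^ 2)} := by
  have hn' : (0 : ℝ) < n := by exact_mod_cast hn
  have hp' : (1 : ℝ) ≤ p := by exact_mod_cast hp
  have hlam1_pos : 0 < lam1 := by
    have : 0 < Real.log (p / δ) := Real.log_pos ((one_lt_div hδ.1).2 (hδ.2.trans_le hp'))
    rw [hlam1]
    positivity
  refine (le_gaussianVec_noise_event hn hp hσ X hX hδ hlam1).trans (measure_mono ?_)
  intro ε hε bhat bb hbhat hbb
  exact (l2sq_mulVec_boosted_add_le hn X bstar hlam2.le hε hbb).trans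
    (l2sq_mulVec_lasso_sub_le hn X bstar hs hRE hlam1_pos hε hbhat)
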